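/- Let p ∈ (1,∞), let Ω ⊆ ℝ^d be a domain, and let V ∈ L^∞_loc(Ω) be real-valued. If Q_V is nonnegative in Ω and admits a ground state v, then v is a positive weak solution of the equation −Δ_p v + V|v|^{p−2}v = 0 in Ω, i.e., ∫_Ω (|∇v|^{p−2}∇v·∇φ + V v^{p−1}φ) dx = 0 for every φ ∈ C_c^∞(Ω). -/

import Mathlib

open MeasureTheory Filter
open scoped Topology RealInnerProductSpace

noncomputable section

abbrev Ed (d : ℕ) := EuclideanSpace ℝ (Fin d)

/-- A smooth test function compactly supported inside Ω. -/
def IsTestOn {d : ℕ} (Ω : Set (Ed d)) (u : Ed d → ℝ) : Prop :=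
  ContDiff ℝ (⊤ : ℕ∞) u ∧ HasCompactSupport u ∧ tsupport u ⊆ Ω

/-- `V ∈ L^∞_loc(Ω)`. -/
def LocBddOn {d : ℕ} (Ω : Set (Ed d)) (V : Ed d → ℝ) : Prop :=
  Measurable V ∧ ∀ K : Set (Ed d), IsCompact K → K ⊆ Ω →
    ∃ M : ℝ, ∀ᵐ x ∂(volume : Measure (Ed d)), x ∈ K → |V x| ≤ M

/-- The functional `Q_V(u) = ∫_Ω (|∇u|^p + V|u|^p) dx`. -/
def Qp {d : ℕ} (p : ℝ) (Ω : Set (Ed d)) (V : Ed d → ℝ) (u : Ed d → ℝ) : ℝ :=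
  ∫ x in Ω, (‖gradient u x‖ ^ p + V x * |u x| ^ p)

/-- `Q_V` is nonnegative in Ω. -/
def NonnegOn {d : ℕ} (p : ℝ) (Ω : Set (Ed d)) (V : Ed d → ℝ) : Prop :=
  ∀ u, IsTestOn Ω u → 0 ≤ Qp p Ω V u

/-- `Q_V` is subcritical (strictly positive) in Ω: there is a continuous function
`W > 0` on Ω with `Q_V(u) ≥ ∫_Ω W|u|^p` for all test functions `u`. -/
def SubcriticalOn {d : ℕ} (p : ℝ) (Ω : Set (Ed d)) (V : Ed d → ℝ) : Prop :=
  ∃ W : Ed d → ℝ, ContinuousOn W Ω ∧ (∀ x ∈ Ω, 0 < W x) ∧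
    ∀ u, IsTestOn Ω u → (∫ x in Ω, W x * |u x| ^ p) ≤ Qp p Ω V u

/-- A null sequence for `Q_V` in Ω. -/
def NullSeqOn {d : ℕ} (p : ℝ) (Ω : Set (Ed d)) (V : Ed d → ℝ)
    (un : ℕ → Ed d → ℝ) : Prop :=
  (∀ n, IsTestOn Ω (un n)) ∧ (∀ n x, 0 ≤ un n x) ∧
  (∃ B : Set (Ed d), IsOpen B ∧ IsCompact (closure B) ∧ closure B ⊆ Ω ∧
    ∀ n, (∫ x in B, |un n x| ^ p) = 1) ∧
  Tendsto (fun n => Qp p Ω V (un n)) atTop (𝓝 0)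

/-- A ground state of `Q_V` in Ω: a positive C¹ function on Ω that is the limit of
a null sequence in `L^p(K)` for every compact `K ⊆ Ω`. -/
def IsGroundStateOn {d : ℕ} (p : ℝ) (Ω : Set (Ed d)) (V : Ed d → ℝ)
    (φ : Ed d → ℝ) : Prop :=
  ContDiffOn ℝ 1 φ Ω ∧ (∀ x ∈ Ω, 0 < φ x) ∧
  ∃ un, NullSeqOn p Ω V un ∧ ∀ K : Set (Ed d), IsCompact K → K ⊆ Ω →
    Tendsto (fun n => ∫ x in K, |un n x - φ x| ^ p) atTop (𝓝 0)

/-- `Q_V` is critical in Ω. -/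
def CriticalOn {d : ℕ} (p : ℝ) (Ω : Set (Ed d)) (V : Ed d → ℝ) : Prop :=
  NonnegOn p Ω V ∧ ∃ φ, IsGroundStateOn p Ω V φ

/-- A positive weak supersolution of `-Δ_p v + V|v|^{p-2}v = 0` in Ω. -/
def IsSupersolOn {d : ℕ} (p : ℝ) (Ω : Set (Ed d)) (V : Ed d → ℝ)
    (v : Ed d → ℝ) : Prop :=
  ContDiffOn ℝ 1 v Ω ∧ (∀ x ∈ Ω, 0 < v x) ∧
  ∀ φ, IsTestOn Ω φ → (∀ x, 0 ≤ φ x) →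
    0 ≤ ∫ x in Ω, (‖gradient v x‖ ^ (p - 2) * ⟪gradient v x, gradient φ x⟫ +
      V x * v x ^ (p - 1) * φ x)

/-- A positive weak solution of `-Δ_p v + V|v|^{p-2}v = 0` in Ω. -/
def IsSolOn {d : ℕ} (p : ℝ) (Ω : Set (Ed d)) (V : Ed d → ℝ)
    (v : Ed d → ℝ) : Prop :=
  ContDiffOn ℝ 1 v Ω ∧ (∀ x ∈ Ω, 0 < v x) ∧
  ∀ φ, IsTestOn Ω φ →
    (∫ x in Ω, (‖gradient v x‖ ^ (p - 2) * ⟪gradient v x, gradient φ x⟫ +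
      V x * v x ^ (p - 1) * φ x)) = 0

lemma pow_ineq {p : ℝ} (hp : 1 < p) {ε : ℝ} (hε : 0 < ε) :
    ∃ C : ℝ, 0 ≤ C ∧ ∀ {F : Type} [NormedAddCommGroup F] (a b : F),
      |‖a‖ ^ p - ‖b‖ ^ p| ≤ ε * ‖b‖ ^ p + C * ‖a - b‖ ^ p := by
  have hp0 : 0 < p := by linarith
  have h1 : Tendsto (fun δ : ℝ => (1 + δ) ^ p) (𝓝 0) (𝓝 1) := by
    have : ContinuousAt (fun δ : ℝ => (1 + δ) ^ p) 0 :=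
      (continuousAt_const.add continuousAt_id).rpow_const (Or.inr hp0.le)
    simpa [ContinuousAt] using this
  have h2 : Tendsto (fun δ : ℝ => (1 - δ) ^ p) (𝓝 0) (𝓝 1) := by
    have : ContinuousAt (fun δ : ℝ => (1 - δ) ^ p) 0 :=
      (continuousAt_const.sub continuousAt_id).rpow_const (Or.inr hp0.le)
    simpa [ContinuousAt] using this
  have e1 := h1.eventually (gt_mem_nhds (show (1:ℝ) < 1 + ε by linarith))
  have e2 := h2.eventually (lt_mem_nhds (show (1:ℝ) - ε < 1 by linarith))
  have e3 : ∀ᶠ δ : ℝ in 𝓝 0, δ < 1 := gt_mem_nhds one_pos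
  have e4 : ∀ᶠ δ : ℝ in 𝓝[>] 0, (0:ℝ) < δ := self_mem_nhdsWithin
  obtain ⟨δ, ⟨⟨h1, h2⟩, h3⟩, h4⟩ :=
    (((e1.and e2).and e3).filter_mono nhdsWithin_le_nhds |>.and e4).exists
  refine ⟨(1 + 1 / δ) ^ p, by positivity, ?_⟩
  intro F _ a b
  have hs := norm_nonneg b
  have hr := norm_nonneg (a - b)
  have ha := norm_nonneg a
  have hab : ‖a‖ ≤ ‖b‖ + ‖a - b‖ := by
    have := norm_add_le b (a - b); simpa using this
  have hba : ‖b‖ ≤ ‖a‖ + ‖a - b‖ := by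
    have := norm_sub_le a (a - b); simpa using this
  by_cases hc : ‖a - b‖ ≤ δ * ‖b‖
  · have u1 : ‖a‖ ^ p ≤ (1 + δ) ^ p * ‖b‖ ^ p := by
      rw [← Real.mul_rpow (by linarith) hs]
      exact Real.rpow_le_rpow ha (by nlinarith) hp0.le
    have u2 : (1 - δ) ^ p * ‖b‖ ^ p ≤ ‖a‖ ^ p := by
      rw [← Real.mul_rpow (by linarith) hs]
      exact Real.rpow_le_rpow (mul_nonneg (by linarith) hs) (by nlinarith) hp0.le
    have u3 : 0 ≤ (1 + 1 / δ) ^ p * ‖a - b‖ ^ p := by positivity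
    have u4 : 0 ≤ ‖b‖ ^ p := by positivity
    rw [abs_le]
    constructor <;> nlinarith
  · push Not at hc
    have v0 : ‖b‖ ≤ (1 / δ) * ‖a - b‖ := by
      rw [one_div, ← div_eq_inv_mul, le_div_iff₀ h4]; linarith
    have v1 : ‖a‖ ^ p ≤ (1 + 1 / δ) ^ p * ‖a - b‖ ^ p := by
      rw [← Real.mul_rpow (by positivity) hr]
      exact Real.rpow_le_rpow ha (by linarith) hp0.le
    have v2 : ‖b‖ ^ p ≤ (1 + 1 / δ) ^ p * ‖a - b‖ ^ p := by
      rw [← Real.mul_rpow (by positivity) hr]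
      exact Real.rpow_le_rpow hs (by linarith) hp0.le
    have u4 : 0 ≤ ε * ‖b‖ ^ p := by positivity
    have u5 : 0 ≤ ‖a‖ ^ p := by positivity
    have u6 : 0 ≤ ‖b‖ ^ p := by positivity
    rw [abs_le]
    constructor <;> linarith

lemma conv_ineq {F : Type} [NormedAddCommGroup F] [NormedSpace ℝ F] {p : ℝ} (hp : 1 < p)
    (a b : F) {t : ℝ} (h0 : 0 ≤ t) (h1 : t ≤ 1) :
    ‖(1 - t) • a + t • b‖ ^ p ≤ (1 - t) * ‖a‖ ^ p + t * ‖b‖ ^ p := by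
  have h := (convexOn_rpow hp.le).2 (x := ‖a‖) (y := ‖b‖) (norm_nonneg a) (norm_nonneg b)
    (sub_nonneg.2 h1) h0 (by ring)
  simp only [smul_eq_mul] at h
  refine le_trans (Real.rpow_le_rpow (norm_nonneg _) ?_ (by linarith)) h
  refine (norm_add_le _ _).trans ?_
  rw [norm_smul, norm_smul, Real.norm_of_nonneg h0, Real.norm_of_nonneg (sub_nonneg.2 h1)]

lemma mix_ineq {F : Type} [NormedAddCommGroup F] [NormedSpace ℝ F] {p : ℝ} (hp : 1 < p)
    {ε C D : ℝ} (hC0 : 0 ≤ C) (hD0 : 0 ≤ D)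
    (hC : ∀ a b : F, |‖a‖ ^ p - ‖b‖ ^ p| ≤ ε * ‖b‖ ^ p + C * ‖a - b‖ ^ p)
    (a b g : F) (s : ℝ) {t : ℝ} (h0 : 0 ≤ t) (h1 : t ≤ 1) (hg : ‖g‖ ^ p ≤ D * t ^ (p - 1)) :
    ‖(1 - t) • a + t • b + s • g‖ ^ p ≤
      (1 - t) * ‖a‖ ^ p + (1 + ε) * (t * ‖b‖ ^ p) + C * (D * |s| ^ p) := by
  rcases h0.eq_or_lt with h | h
  · subst h
    rw [Real.zero_rpow (by linarith), mul_zero] at hg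
    have hD : g = 0 := by
      by_contra hne
      have : 0 < ‖g‖ ^ p := Real.rpow_pos_of_pos (norm_pos_iff.2 hne) p
      linarith
    subst hD
    have : 0 ≤ C * (D * |s| ^ p) := by positivity
    simp; exact this
  · have e : (1 - t) • a + t • b + s • g = (1 - t) • a + t • (b + (s / t) • g) := by
      rw [smul_add, smul_smul, mul_div_cancel₀ _ h.ne']; abel
    rw [e]
    refine (conv_ineq hp _ _ h0 h1).trans ?_
    have k := (abs_le.1 (hC (b + (s / t) • g) b)).2
    rw [add_sub_cancel_left, norm_smul, Real.norm_eq_abs, abs_div, abs_of_pos h,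
      Real.mul_rpow (by positivity) (norm_nonneg g), Real.div_rpow (abs_nonneg s) h0] at k
    have k2 : t * (|s| ^ p / t ^ p * ‖g‖ ^ p) ≤ D * |s| ^ p := by
      have : t * (|s| ^ p / t ^ p * ‖g‖ ^ p) ≤ t * (|s| ^ p / t ^ p * (D * t ^ (p - 1))) := by
        gcongr
      refine this.trans (le_of_eq ?_)
      rw [Real.rpow_sub_one h.ne']
      have : t ^ p ≠ 0 := (Real.rpow_pos_of_pos h p).ne'
      field_simp
    have k3 := mul_le_mul_of_nonneg_left k2 hC0
    have k4 := mul_le_mul_of_nonneg_left k h0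
    nlinarith

lemma young_ineq {F : Type} [NormedAddCommGroup F] [InnerProductSpace ℝ F] {p : ℝ} (hp : 1 < p)
    (a b : F) :
    ‖b‖ ^ p + p * (‖b‖ ^ (p - 2) * ⟪b, a - b⟫) ≤ ‖a‖ ^ p := by
  by_cases hb : b = 0
  · subst hb; simp [Real.zero_rpow (show p ≠ 0 by linarith)]; positivity
  have hb0 : 0 < ‖b‖ := norm_pos_iff.2 hb
  have hpq : p.HolderConjugate (p / (p - 1)) := Real.HolderConjugate.conjExponent hp
  have y := Real.young_inequality_of_nonneg (norm_nonneg a)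
    (Real.rpow_nonneg (norm_nonneg b) (p - 1)) hpq
  rw [← Real.rpow_mul hb0.le, mul_div_cancel₀ _ (show p - 1 ≠ 0 by linarith)] at y
  have y2 : p * (‖a‖ * ‖b‖ ^ (p - 1)) ≤ ‖a‖ ^ p + (p - 1) * ‖b‖ ^ p := by
    have := mul_le_mul_of_nonneg_left y (show (0:ℝ) ≤ p by linarith)
    refine this.trans (le_of_eq ?_)
    have : p - 1 ≠ 0 := by linarith
    field_simp
  have i1 : ‖b‖ ^ (p - 2) * ⟪b, a⟫ ≤ ‖a‖ * ‖b‖ ^ (p - 1) := by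
    have := mul_le_mul_of_nonneg_left (real_inner_le_norm b a) (Real.rpow_nonneg hb0.le (p - 2))
    refine this.trans (le_of_eq ?_)
    rw [show p - 1 = (p - 2) + 1 by ring, Real.rpow_add_one hb0.ne']; ring
  have i2 : ‖b‖ ^ (p - 2) * ⟪b, b⟫ = ‖b‖ ^ p := by
    rw [real_inner_self_eq_norm_sq, ← Real.rpow_natCast, ← Real.rpow_add hb0]; norm_num
  rw [inner_sub_right, mul_sub, i2]
  nlinarith

lemma cont_H {F : Type} [NormedAddCommGroup F] [InnerProductSpace ℝ F] {p : ℝ} (hp : 1 < p) :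
    Continuous (fun x : F => ‖x‖ ^ (p - 2) • x) := by
  rw [continuous_iff_continuousAt]
  intro x
  by_cases hx : x = 0
  · subst hx
    rw [ContinuousAt, smul_zero, tendsto_zero_iff_norm_tendsto_zero]
    have : ContinuousAt (fun x : F => ‖x‖ ^ (p - 1)) 0 :=
      continuous_norm.continuousAt.rpow_const (Or.inr (by linarith))
    rw [ContinuousAt, norm_zero, Real.zero_rpow (by linarith)] at this
    refine this.congr fun y => ?_
    by_cases hy : y = 0
    · subst hy; simp [Real.zero_rpow (show p - 1 ≠ 0 by linarith)]
    rw [norm_smul, Real.norm_of_nonneg (by positivity), show p - 1 = (p - 2) + 1 by ring,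
      Real.rpow_add_one (norm_ne_zero_iff.2 hy)]
  · exact (continuous_norm.continuousAt.rpow_const (Or.inl (norm_ne_zero_iff.2 hx))).smul
      continuousAt_id

lemma one_add_pow {p : ℝ} (hp : 1 < p) {x : ℝ} (hx : 0 ≤ x) : x ≤ 1 + x ^ p := by
  rcases le_total x 1 with h | h
  · have : 0 ≤ x ^ p := by positivity
    linarith
  · have := Real.self_le_rpow_of_one_le h hp.le
    linarith

lemma cutoff {d : ℕ} {Ω K : Set (Ed d)} (hΩ : IsOpen Ω) (hK : IsCompact K) (hKΩ : K ⊆ Ω) :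
    ∃ ζ : Ed d → ℝ, IsTestOn Ω ζ ∧ (∀ x, 0 ≤ ζ x) ∧ (∀ x, ζ x ≤ 1) ∧
      (∀ᶠ x in 𝓝ˢ K, ζ x = 1) := by
  obtain ⟨L, hL, hKL, hLΩ⟩ := exists_compact_between hK hΩ hKΩ
  obtain ⟨f, h1, h0, hf⟩ := exists_contMDiffMap_one_nhds_of_subset_interior
    (n := (⊤ : ℕ∞)) (modelWithCornersSelf ℝ (Ed d)) hK.isClosed hKL
  have hs : tsupport f ⊆ L := by
    refine closure_minimal ?_ hL.isClosed
    intro x hx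
    by_contra h
    exact hx (h0 x h)
  exact ⟨f, ⟨f.contMDiff.contDiff, hL.of_isClosed_subset (isClosed_tsupport _) hs,
    hs.trans hLΩ⟩, fun x => (hf x).1, fun x => (hf x).2, h1⟩

def C1On {d : ℕ} (Ω : Set (Ed d)) (u : Ed d → ℝ) : Prop :=
  ContDiff ℝ 1 u ∧ HasCompactSupport u ∧ tsupport u ⊆ Ω

lemma IsTestOn.c1 {d : ℕ} {Ω : Set (Ed d)} {u : Ed d → ℝ} (h : IsTestOn Ω u) : C1On Ω u :=
  ⟨h.1.of_le (by exact_mod_cast le_top), h.2.1, h.2.2⟩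

lemma grad_eq {d : ℕ} (u : Ed d → ℝ) (x : Ed d) :
    gradient u x = (InnerProductSpace.toDual ℝ (Ed d)).symm (fderiv ℝ u x) := rfl

lemma cont_grad {d : ℕ} {u : Ed d → ℝ} (h : ContDiff ℝ 1 u) : Continuous (gradient u) :=
  (LinearIsometryEquiv.continuous _).comp (h.continuous_fderiv one_ne_zero)

lemma grad_zero {d : ℕ} {u : Ed d → ℝ} {x : Ed d} (h : x ∉ tsupport u) : gradient u x = 0 := by
  rw [grad_eq, fderiv_of_notMem_tsupport ℝ h, map_zero]

lemma tsupport_grad {d : ℕ} (u : Ed d → ℝ) : tsupport (gradient u) ⊆ tsupport u := by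
  refine closure_minimal ?_ (isClosed_tsupport _)
  intro x hx
  by_contra h
  exact hx (grad_zero h)

lemma cs_grad {d : ℕ} {u : Ed d → ℝ} (h : HasCompactSupport u) :
    HasCompactSupport (gradient u) :=
  h.of_isClosed_subset (isClosed_tsupport _) (tsupport_grad u)

lemma cont_pow {d : ℕ} {F : Type} [NormedAddCommGroup F] {p : ℝ} (hp : 1 < p) {f : Ed d → F}
    (hf : Continuous f) : Continuous (fun x => ‖f x‖ ^ p) :=
  hf.norm.rpow_const fun _ => Or.inr (by linarith)

lemma pow_zero' {F : Type} [NormedAddCommGroup F] {p : ℝ} (hp : 1 < p) :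
    ‖(0:F)‖ ^ p = 0 := by
  rw [norm_zero, Real.zero_rpow (by linarith)]

lemma cs_pow {d : ℕ} {F : Type} [NormedAddCommGroup F] {p : ℝ} (hp : 1 < p) {f : Ed d → F}
    (hf : HasCompactSupport f) : HasCompactSupport (fun x => ‖f x‖ ^ p) :=
  hf.comp_left (g := fun y => ‖y‖ ^ p) (pow_zero' hp)

lemma ts_sub {d : ℕ} {F G : Type} [Zero F] [Zero G] {f : Ed d → F} {g : Ed d → G}
    (h : ∀ x, f x = 0 → g x = 0) : tsupport g ⊆ tsupport f :=
  closure_mono fun x hx hf => hx (h x hf)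

lemma ts_zero {d : ℕ} {F : Type} [Zero F] {f : Ed d → F} {x : Ed d} (h : x ∉ tsupport f) :
    f x = 0 := image_eq_zero_of_notMem_tsupport h

lemma int_V {d : ℕ} {Ω : Set (Ed d)} {V : Ed d → ℝ} (hV : LocBddOn Ω V) {f : Ed d → ℝ}
    (hf : Continuous f) (hc : HasCompactSupport f) (hs : tsupport f ⊆ Ω) :
    Integrable (fun x => V x * f x) := by
  obtain ⟨M, hM⟩ := hV.2 _ hc hs
  refine Integrable.mono' (g := fun x => M * |f x|)
    ((hf.integrable_of_hasCompactSupport hc).abs.const_mul M)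
    (hV.1.aestronglyMeasurable.mul hf.aestronglyMeasurable) ?_
  filter_upwards [hM] with x hx
  rw [Real.norm_eq_abs, abs_mul]
  by_cases h : x ∈ tsupport f
  · exact mul_le_mul_of_nonneg_right (hx h) (abs_nonneg _)
  · rw [ts_zero h]; simp

lemma int_grad {d : ℕ} {p : ℝ} (hp : 1 < p) {Ω : Set (Ed d)} {u : Ed d → ℝ} (h : C1On Ω u) :
    Integrable (fun x => ‖gradient u x‖ ^ p) :=
  (cont_pow hp (cont_grad h.1)).integrable_of_hasCompactSupport (cs_pow hp (cs_grad h.2.1))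

lemma int_Vu {d : ℕ} {p : ℝ} (hp : 1 < p) {Ω : Set (Ed d)} {V : Ed d → ℝ} (hV : LocBddOn Ω V)
    {u : Ed d → ℝ} (h : C1On Ω u) :
    Integrable (fun x => V x * ‖u x‖ ^ p) :=
  int_V hV (cont_pow hp h.1.continuous) (cs_pow hp h.2.1)
    ((ts_sub fun x hx => by rw [hx, pow_zero' hp]).trans h.2.2)

lemma Q_eq {d : ℕ} {p : ℝ} (hp : 1 < p) {Ω : Set (Ed d)} {V : Ed d → ℝ} (hV : LocBddOn Ω V)
    {u : Ed d → ℝ} (h : C1On Ω u) :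
    Qp p Ω V u = (∫ x, ‖gradient u x‖ ^ p) + ∫ x, V x * ‖u x‖ ^ p := by
  rw [Qp, setIntegral_eq_integral_of_forall_compl_eq_zero,
    ← integral_add (int_grad hp h) (int_Vu hp hV h)]
  · rfl
  · intro x hx
    have hx' : x ∉ tsupport u := fun h' => hx (h.2.2 h')
    rw [grad_zero hx', ts_zero hx', pow_zero' hp, abs_zero, Real.zero_rpow (by linarith)]
    simp

lemma conv_lem {d : ℕ} {F : Type} [NormedAddCommGroup F] {p : ℝ} (hp : 1 < p)
    {K : Set (Ed d)} (hK : IsCompact K) {W : Ed d → ℝ} (hW : Measurable W) {M : ℝ}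
    (hM : ∀ᵐ x ∂(volume : Measure (Ed d)), x ∈ K → |W x| ≤ M)
    {f : ℕ → Ed d → F} {g : Ed d → F} (hf : ∀ n, Continuous (f n)) (hg : Continuous g)
    (h : Tendsto (fun n => ∫ x in K, ‖f n x - g x‖ ^ p) atTop (𝓝 0)) :
    Tendsto (fun n => ∫ x in K, W x * ‖f n x‖ ^ p) atTop (𝓝 (∫ x in K, W x * ‖g x‖ ^ p)) := by
  have hci : ∀ {k : Ed d → ℝ}, Continuous k → IntegrableOn k K :=
    fun hk => hk.continuousOn.integrableOn_compact hK
  have hM' : ∀ᵐ x ∂(volume.restrict K), |W x| ≤ max M 0 := by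
    rw [ae_restrict_iff' hK.measurableSet]
    filter_upwards [hM] with x hx hxK using (hx hxK).trans (le_max_left _ _)
  have hWi : ∀ {k : Ed d → ℝ}, Continuous k → IntegrableOn (fun x => W x * k x) K := by
    intro k hk
    refine Integrable.mono' (g := fun x => max M 0 * |k x|) ((hci hk).abs.const_mul _)
      (hW.aestronglyMeasurable.mul hk.aestronglyMeasurable) ?_
    filter_upwards [hM'] with x hx
    rw [Real.norm_eq_abs, abs_mul]
    exact mul_le_mul_of_nonneg_right hx (abs_nonneg _)
  set M' := max M 0 with hM'def
  have hM0 : 0 ≤ M' := le_max_right _ _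
  set I := ∫ x in K, ‖g x‖ ^ p with hI
  have hI0 : 0 ≤ I := integral_nonneg fun x => by positivity
  rw [Metric.tendsto_atTop]
  intro e he
  obtain ⟨C, hC0, hC⟩ := pow_ineq hp (show 0 < e / (2 * (M' * I + 1)) by positivity)
  have hb : ∀ n, dist (∫ x in K, W x * ‖f n x‖ ^ p) (∫ x in K, W x * ‖g x‖ ^ p) ≤
      M' * (e / (2 * (M' * I + 1)) * I + C * ∫ x in K, ‖f n x - g x‖ ^ p) := by
    intro n
    have c1 := cont_pow hp (hf n)
    have c2 := cont_pow hp hg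
    have c3 : Continuous fun x => ‖f n x - g x‖ ^ p := cont_pow hp ((hf n).sub hg)
    rw [Real.dist_eq, ← integral_sub (hWi c1) (hWi c2), ← Real.norm_eq_abs]
    have : M' * (e / (2 * (M' * I + 1)) * I + C * ∫ x in K, ‖f n x - g x‖ ^ p) =
      ∫ x in K, M' * (e / (2 * (M' * I + 1)) * ‖g x‖ ^ p + C * ‖f n x - g x‖ ^ p) := by
      rw [integral_const_mul, integral_add ((hci c2).const_mul _) ((hci c3).const_mul _),
        integral_const_mul, integral_const_mul]
    rw [this]
    refine norm_integral_le_of_norm_le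
      ((((hci c2).const_mul _).add ((hci c3).const_mul _)).const_mul _) ?_
    filter_upwards [hM'] with x hx
    rw [← mul_sub, norm_mul, Real.norm_eq_abs, Real.norm_eq_abs]
    exact mul_le_mul hx (hC _ _) (abs_nonneg _) hM0
  have hlim : Tendsto (fun n => M' * (C * ∫ x in K, ‖f n x - g x‖ ^ p)) atTop (𝓝 0) := by
    simpa using (h.const_mul C).const_mul M'
  obtain ⟨N, hN⟩ := (Metric.tendsto_atTop.1 hlim) (e / 2) (by positivity)
  refine ⟨N, fun n hn => (hb n).trans_lt ?_⟩
  have h1 := hN n hn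
  rw [Real.dist_eq, sub_zero] at h1
  have h2 := (abs_lt.1 h1).2
  have h3 : M' * (e / (2 * (M' * I + 1)) * I) ≤ e / 2 := by
    rw [show M' * (e / (2 * (M' * I + 1)) * I) = (M' * I) * e / (2 * (M' * I + 1)) by ring,
      div_le_div_iff₀ (by positivity) (by norm_num)]
    nlinarith [mul_nonneg hM0 hI0]
  rw [mul_add]; linarith

lemma approx_c1 {d : ℕ} {Ω : Set (Ed d)} (hΩ : IsOpen Ω) {u : Ed d → ℝ} (h : C1On Ω u) :
    ∃ K : Set (Ed d), IsCompact K ∧ K ⊆ Ω ∧ tsupport u ⊆ K ∧ ∀ ε : ℝ, 0 < ε →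
      ∃ w, IsTestOn Ω w ∧ tsupport w ⊆ K ∧ (∀ x, ‖w x - u x‖ ≤ ε) ∧
        ∀ x, ‖gradient w x - gradient u x‖ ≤ ε := by
  have hc : IsCompact (tsupport u) := h.2.1
  obtain ⟨δ, hδ, hδΩ⟩ := hc.exists_cthickening_subset_open hΩ h.2.2
  refine ⟨Metric.cthickening δ (tsupport u), hc.cthickening, hδΩ,
    Metric.self_subset_cthickening _, ?_⟩
  intro ε hε
  have uc1 := h.2.1.uniformContinuous_of_continuous h.1.continuous
  have cfd := h.1.continuous_fderiv one_ne_zero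
  have uc2 := (h.2.1.fderiv (𝕜 := ℝ)).uniformContinuous_of_continuous cfd
  obtain ⟨δ1, hδ1, h1⟩ := Metric.uniformContinuous_iff.1 uc1 ε hε
  obtain ⟨δ2, hδ2, h2⟩ := Metric.uniformContinuous_iff.1 uc2 ε hε
  set r := min δ (min δ1 δ2) with hr
  have hr0 : 0 < r := lt_min hδ (lt_min hδ1 hδ2)
  have hrδ : r ≤ δ := min_le_left _ _
  have hrδ1 : r ≤ δ1 := (min_le_right _ _).trans (min_le_left _ _)
  have hrδ2 : r ≤ δ2 := (min_le_right _ _).trans (min_le_right _ _)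
  set φ : ContDiffBump (0 : Ed d) := ⟨r / 2, r, half_pos hr0, half_lt_self hr0⟩ with hφ
  set w : Ed d → ℝ := convolution (φ.normed volume) u (ContinuousLinearMap.lsmul ℝ ℝ) volume
    with hw
  have hsupp : tsupport w ⊆ Metric.cthickening δ (tsupport u) := by
    refine closure_minimal ?_ Metric.isClosed_cthickening
    intro x hx
    by_contra hn
    refine hx ?_
    have hz : ∀ y ∈ Metric.ball x r, u y = 0 := by
      intro y hy
      refine ts_zero fun hyt => hn ?_
      exact Metric.mem_cthickening_of_dist_le x y δ _ hyt
        (by rw [dist_comm]; exact (Metric.mem_ball.1 hy).le.trans hrδ)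
    have := φ.dist_normed_convolution_le (μ := volume) (g := u) (x₀ := x) (ε := 0)
      h.1.continuous.aestronglyMeasurable (by
        intro y hy
        rw [hz y hy, hz x (Metric.mem_ball_self hr0), dist_self])
    rw [hz x (Metric.mem_ball_self hr0)] at this
    exact dist_le_zero.1 this
  refine ⟨w, ⟨?_, hc.cthickening.of_isClosed_subset (isClosed_tsupport _) hsupp,
    hsupp.trans hδΩ⟩, hsupp, ?_, ?_⟩
  · exact φ.hasCompactSupport_normed.contDiff_convolution_left _ φ.contDiff_normed
      h.1.continuous.locallyIntegrable
  · intro x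
    rw [← dist_eq_norm]
    refine φ.dist_normed_convolution_le h.1.continuous.aestronglyMeasurable fun y hy => ?_
    exact (h1 (lt_of_lt_of_le hy hrδ1)).le
  · intro x
    have hd := h.2.1.hasFDerivAt_convolution_right (ContinuousLinearMap.lsmul ℝ ℝ)
      (φ.continuous_normed (μ := volume)).locallyIntegrable (μ := volume) h.1 x
    rw [grad_eq, grad_eq, ← map_sub, LinearIsometryEquiv.norm_map, hd.fderiv, ← dist_eq_norm]
    exact φ.dist_normed_convolution_le (μ := volume) (g := fderiv ℝ u) (x₀ := x) (ε := ε)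
      cfd.aestronglyMeasurable fun y hy => (h2 (lt_of_lt_of_le hy hrδ2)).le

lemma int_K {d : ℕ} {K : Set (Ed d)} {f : Ed d → ℝ} (h : ∀ x, x ∉ K → f x = 0) :
    ∫ x in K, f x = ∫ x, f x :=
  setIntegral_eq_integral_of_forall_compl_eq_zero h

lemma small_lem {d : ℕ} {F : Type} [NormedAddCommGroup F] {p : ℝ} (hp : 1 < p)
    {K : Set (Ed d)} (hK : IsCompact K) {f : ℕ → Ed d → F}
    (h : ∀ n x, ‖f n x‖ ≤ 1 / ((n:ℝ) + 1)) :
    Tendsto (fun n => ∫ x in K, ‖f n x‖ ^ p) atTop (𝓝 0) := by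
  have h0 : Tendsto (fun n : ℕ => (1 / ((n:ℝ) + 1)) ^ p * volume.real K) atTop (𝓝 0) := by
    have := (tendsto_one_div_add_atTop_nhds_zero_nat (𝕜 := ℝ)).rpow_const
      (p := p) (Or.inr (by linarith))
    rw [Real.zero_rpow (by linarith)] at this
    simpa using this.mul_const (volume.real K)
  refine squeeze_zero (fun n => integral_nonneg fun x => by positivity) (fun n => ?_) h0
  have := norm_setIntegral_le_of_norm_le_const (μ := volume) (s := K)
    (f := fun x => ‖f n x‖ ^ p) (C := (1 / ((n:ℝ) + 1)) ^ p) hK.measure_lt_top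
    (fun x _ => by
      rw [Real.norm_of_nonneg (by positivity)]
      exact Real.rpow_le_rpow (norm_nonneg _) (h n x) (by linarith))
  exact (le_abs_self _).trans this

lemma nonneg_c1 {d : ℕ} {p : ℝ} (hp : 1 < p) {Ω : Set (Ed d)} (hΩ : IsOpen Ω) {V : Ed d → ℝ}
    (hV : LocBddOn Ω V) (hnn : NonnegOn p Ω V) {u : Ed d → ℝ} (h : C1On Ω u) :
    0 ≤ (∫ x, ‖gradient u x‖ ^ p) + ∫ x, V x * ‖u x‖ ^ p := by
  obtain ⟨K, hK, hKΩ, huK, hap⟩ := approx_c1 hΩ h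
  choose w hw1 hw2 hw3 hw4 using fun n : ℕ => hap (1 / ((n:ℝ) + 1)) (by positivity)
  obtain ⟨M, hM⟩ := hV.2 K hK hKΩ
  have t1 := conv_lem hp hK (W := fun _ => 1) measurable_const (M := 1) (by simp)
    (fun n => cont_grad (hw1 n).c1.1) (cont_grad h.1) (small_lem hp hK hw4)
  have t2 := conv_lem hp hK hV.1 hM
    (fun n => (hw1 n).c1.1.continuous) h.1.continuous (small_lem hp hK hw3)
  have t := t1.add t2
  have z : ∀ k : Ed d → ℝ, tsupport k ⊆ K → (∫ x in K, 1 * ‖gradient k x‖ ^ p) +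
      (∫ x in K, V x * ‖k x‖ ^ p) = (∫ x, ‖gradient k x‖ ^ p) + ∫ x, V x * ‖k x‖ ^ p := by
    intro k hk
    rw [int_K, int_K]
    · simp
    · intro x hx
      rw [ts_zero fun h' => hx (hk h'), pow_zero' hp, mul_zero]
    · intro x hx
      rw [grad_zero fun h' => hx (hk h'), pow_zero' hp, mul_zero]
  rw [z u huK] at t
  refine ge_of_tendsto' t fun n => ?_
  rw [z _ (hw2 n), ← Q_eq hp hV (hw1 n).c1]
  exact hnn _ (hw1 n)

lemma cutoff2 {d : ℕ} {p : ℝ} (hp : 1 < p) {Ω K : Set (Ed d)} (hΩ : IsOpen Ω)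
    (hK : IsCompact K) (hKΩ : K ⊆ Ω) :
    ∃ η : Ed d → ℝ, IsTestOn Ω η ∧ (∀ x, 0 ≤ η x) ∧ (∀ x, η x ≤ 1) ∧
      (∀ x ∈ K, η x = 1) ∧ ∃ D : ℝ, 0 ≤ D ∧ ∀ x, ‖gradient η x‖ ^ p ≤ D * η x ^ (p - 1) := by
  obtain ⟨ζ, hζ, h0, h1, hK1⟩ := cutoff hΩ hK hKΩ
  obtain ⟨m, hm⟩ := exists_nat_ge p
  have hm1 : 1 ≤ m := by
    have : (1:ℝ) < m := by linarith
    exact_mod_cast this.le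
  have hm0 : m ≠ 0 := by omega
  have hts : tsupport (fun x => ζ x ^ m) ⊆ tsupport ζ := ts_sub fun x hx => by simp [hx, hm0]
  refine ⟨fun x => ζ x ^ m, ⟨hζ.1.pow m,
    hζ.2.1.of_isClosed_subset (isClosed_tsupport _) hts, hts.trans hζ.2.2⟩,
    fun x => pow_nonneg (h0 x) m, fun x => pow_le_one₀ (h0 x) (h1 x), ?_, ?_⟩
  · intro x hx
    simp only [hK1.self_of_nhdsSet x hx, one_pow]
  · obtain ⟨B, hB⟩ := (cs_grad hζ.2.1).exists_bound_of_continuous (cont_grad hζ.c1.1)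
    have hB0 : 0 ≤ B := (norm_nonneg _).trans (hB 0)
    refine ⟨(m * B) ^ p, by positivity, fun x => ?_⟩
    have hd : DifferentiableAt ℝ ζ x := hζ.c1.1.differentiable one_ne_zero x
    have hg : gradient (fun x => ζ x ^ m) x = (m * ζ x ^ (m - 1)) • gradient ζ x := by
      rw [grad_eq, grad_eq, (hd.hasFDerivAt.pow m).fderiv, map_smul]
      simp [nsmul_eq_mul]
    have hz := h0 x
    rw [hg, norm_smul, Real.norm_of_nonneg (by positivity)]
    calc (m * ζ x ^ (m - 1) * ‖gradient ζ x‖) ^ p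
        ≤ ((m * B) * ζ x ^ (m - 1)) ^ p := by
          refine Real.rpow_le_rpow (by positivity) ?_ (by linarith)
          have := mul_le_mul_of_nonneg_left (hB x) (show 0 ≤ m * ζ x ^ (m - 1) by positivity)
          linarith
      _ = (m * B) ^ p * (ζ x ^ (m - 1)) ^ p := Real.mul_rpow (by positivity) (by positivity)
      _ ≤ (m * B) ^ p * (ζ x ^ m) ^ (p - 1) := by
          refine mul_le_mul_of_nonneg_left ?_ (by positivity)
          rw [← Real.rpow_natCast, ← Real.rpow_natCast, ← Real.rpow_mul hz, ← Real.rpow_mul hz]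
          refine Real.rpow_le_rpow_of_exponent_ge' hz (h1 x) (by
            apply mul_nonneg <;> [positivity; linarith]) ?_
          rw [Nat.cast_sub hm1]
          push_cast
          nlinarith

lemma l1_lem {d : ℕ} {p : ℝ} (hp : 1 < p) {S : Set (Ed d)} (hS : IsCompact S)
    {f : ℕ → Ed d → ℝ} (hf : ∀ n, Continuous (f n))
    (h : Tendsto (fun n => ∫ x in S, ‖f n x‖ ^ p) atTop (𝓝 0)) :
    Tendsto (fun n => ∫ x in S, ‖f n x‖) atTop (𝓝 0) := by
  have hci : ∀ {k : Ed d → ℝ}, Continuous k → IntegrableOn k S :=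
    fun hk => hk.continuousOn.integrableOn_compact hS
  rw [Metric.tendsto_atTop]
  intro e he
  set m := volume.real S with hm
  have hm0 : 0 ≤ m := measureReal_nonneg
  set ε := e / (2 * (m + 1)) with hε
  have hε0 : 0 < ε := by positivity
  have hb : ∀ n, ∫ x in S, ‖f n x‖ ≤ m * ε + (ε / ε ^ p) * ∫ x in S, ‖f n x‖ ^ p := by
    intro n
    have c := cont_pow hp (hf n)
    have : m * ε + (ε / ε ^ p) * ∫ x in S, ‖f n x‖ ^ p =
        ∫ x in S, (ε + (ε / ε ^ p) * ‖f n x‖ ^ p) := by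
      rw [integral_add (hci continuous_const) ((hci c).const_mul _), integral_const_mul,
        setIntegral_const, smul_eq_mul]
    rw [this]
    refine integral_mono (hci (hf n).norm)
      ((hci continuous_const).add ((hci c).const_mul _)) fun x => ?_
    have := one_add_pow hp (x := ‖f n x‖ / ε) (by positivity)
    rw [Real.div_rpow (norm_nonneg _) hε0.le, div_le_iff₀ hε0] at this
    refine this.trans (le_of_eq ?_)
    ring
  have hlim : Tendsto (fun n => (ε / ε ^ p) * ∫ x in S, ‖f n x‖ ^ p) atTop (𝓝 0) := by
    simpa using h.const_mul (ε / ε ^ p)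
  obtain ⟨N, hN⟩ := (Metric.tendsto_atTop.1 hlim) (e / 2) (by positivity)
  refine ⟨N, fun n hn => ?_⟩
  have h1 := hN n hn
  rw [Real.dist_eq, sub_zero] at h1 ⊢
  have h2 := (abs_lt.1 h1).2
  rw [abs_of_nonneg (integral_nonneg fun x => norm_nonneg _)]
  have h3 : m * ε ≤ e / 2 := by
    rw [hε, show m * (e / (2 * (m + 1))) = m * e / (2 * (m + 1)) by ring,
      div_le_div_iff₀ (by positivity) (by norm_num)]
    nlinarith
  linarith [hb n]

lemma mul_lem {d : ℕ} {p : ℝ} (hp : 1 < p) {S : Set (Ed d)} (hS : IsCompact S)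
    {f : ℕ → Ed d → ℝ} (hf : ∀ n, Continuous (f n))
    (h : Tendsto (fun n => ∫ x in S, ‖f n x‖ ^ p) atTop (𝓝 0))
    {g : Ed d → ℝ} (hg : Continuous g) (hgS : tsupport g ⊆ S) :
    Tendsto (fun n => ∫ x, g x * f n x) atTop (𝓝 0) := by
  have hci : ∀ {k : Ed d → ℝ}, Continuous k → IntegrableOn k S :=
    fun hk => hk.continuousOn.integrableOn_compact hS
  have hgc : HasCompactSupport g := hS.of_isClosed_subset (isClosed_tsupport _) hgS
  obtain ⟨B, hB⟩ := hgc.exists_bound_of_continuous hg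
  have hl := (l1_lem hp hS hf h).const_mul B
  rw [mul_zero] at hl
  refine squeeze_zero_norm (fun n => ?_) hl
  rw [← int_K (K := S) (fun x hx => by rw [ts_zero fun h' => hx (hgS h'), zero_mul]),
    ← integral_const_mul]
  refine norm_integral_le_of_norm_le ((hci (hf n).norm).const_mul B) ?_
  refine Eventually.of_forall fun x => ?_
  rw [norm_mul]
  exact mul_le_mul_of_nonneg_right (hB x) (norm_nonneg _)

lemma ibp_lem {d : ℕ} {p : ℝ} (hp : 1 < p) {S : Set (Ed d)} (hS : IsCompact S)
    {f : ℕ → Ed d → ℝ} (hf : ∀ n, ContDiff ℝ 1 (f n))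
    (h : Tendsto (fun n => ∫ x in S, ‖f n x‖ ^ p) atTop (𝓝 0))
    {X : Ed d → Ed d} (hX : ContDiff ℝ 1 X) (hXS : tsupport X ⊆ S) :
    Tendsto (fun n => ∫ x, ⟪X x, gradient (f n) x⟫) atTop (𝓝 0) := by
  have hXc : HasCompactSupport X := hS.of_isClosed_subset (isClosed_tsupport _) hXS
  have hXi : ∀ i, ContDiff ℝ 1 (fun x => X x i) := fun i => by
    have := (EuclideanSpace.proj (𝕜 := ℝ) i : Ed d →L[ℝ] ℝ).contDiff.comp hX
    exact this
  have hXis : ∀ i, tsupport (fun x => X x i) ⊆ tsupport X := fun i =>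
    ts_sub fun x hx => by simp [hx]
  have hXic : ∀ i, HasCompactSupport (fun x => X x i) := fun i =>
    hXc.of_isClosed_subset (isClosed_tsupport _) (hXis i)
  let e : Fin d → Ed d := fun i => EuclideanSpace.single i 1
  have hdc : ∀ i, Continuous (fun x => fderiv ℝ (fun x => X x i) x (e i)) := fun i =>
    ((hXi i).continuous_fderiv one_ne_zero).clm_apply continuous_const
  have hds : ∀ i, tsupport (fun x => fderiv ℝ (fun x => X x i) x (e i)) ⊆ S := fun i => by
    refine (closure_minimal ?_ (isClosed_tsupport _)).trans ((hXis i).trans hXS)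
    intro x hx
    by_contra hn
    refine hx ?_
    simp only
    rw [fderiv_of_notMem_tsupport ℝ hn]; rfl
  have key : ∀ n, ∫ x, ⟪X x, gradient (f n) x⟫ =
      ∑ i, - ∫ x, fderiv ℝ (fun x => X x i) x (e i) * f n x := by
    intro n
    have hfc : ∀ i, Continuous (fun x => fderiv ℝ (f n) x (e i)) := fun i =>
      ((hf n).continuous_fderiv one_ne_zero).clm_apply continuous_const
    have hint : ∀ i, Integrable (fun x => X x i * fderiv ℝ (f n) x (e i)) := fun i =>
      ((hXi i).continuous.mul (hfc i)).integrable_of_hasCompactSupport (hXic i).mul_right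
    have : ∀ x, ⟪X x, gradient (f n) x⟫ = ∑ i, X x i * fderiv ℝ (f n) x (e i) := by
      intro x
      rw [real_inner_comm, inner_gradient_left]
      have hx : X x = ∑ i, X x i • e i := by
        ext j
        simp [e, Finset.sum_apply, Pi.single_apply]
      conv_lhs => rw [hx]
      rw [map_sum]
      simp [map_smul]
    simp_rw [this]
    rw [integral_finsetSum _ fun i _ => hint i]
    refine Finset.sum_congr rfl fun i _ => ?_
    have hcs : HasCompactSupport (fun x => fderiv ℝ (fun x => X x i) x (e i)) :=
      hS.of_isClosed_subset (isClosed_tsupport _) (hds i)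
    exact integral_mul_fderiv_eq_neg_fderiv_mul_of_integrable
      (((hdc i).mul (hf n).continuous).integrable_of_hasCompactSupport hcs.mul_right)
      (hint i)
      (((hXi i).continuous.mul (hf n).continuous).integrable_of_hasCompactSupport
        (hXic i).mul_right)
      (fun x _ => (hXi i).differentiable one_ne_zero x)
      (fun x _ => (hf n).differentiable one_ne_zero x)
  simp_rw [key]
  have := tendsto_finsetSum (Finset.univ : Finset (Fin d)) fun i _ =>
    (mul_lem hp hS (fun n => (hf n).continuous) h (hdc i) (hds i)).neg
  simpa using this

lemma int_mul {d : ℕ} {η g : Ed d → ℝ} (hη : Continuous η) (hc : HasCompactSupport η)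
    (hg : Continuous g) : Integrable (fun x => η x * g x) :=
  (hη.mul hg).integrable_of_hasCompactSupport hc.mul_right

lemma lower_lem {d : ℕ} {p : ℝ} (hp : 1 < p) {η v : Ed d → ℝ} (hη : ContDiff ℝ 1 η)
    (hηc : HasCompactSupport η) (h0 : ∀ x, 0 ≤ η x)
    (hv : ContDiff ℝ 1 v) (hvc : HasCompactSupport v)
    {u : ℕ → Ed d → ℝ} (hu : ∀ n, ContDiff ℝ 1 (u n))
    (h : Tendsto (fun n => ∫ x in tsupport η, ‖u n x - v x‖ ^ p) atTop (𝓝 0))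
    {ε : ℝ} (hε : 0 < ε) :
    ∃ o : ℕ → ℝ, Tendsto o atTop (𝓝 0) ∧ ∀ n,
      (∫ x, η x * ‖gradient v x‖ ^ p) + o n ≤
        (1 + p * ε) * (∫ x, η x * ‖gradient (u n) x‖ ^ p) +
          p * ε * ∫ x, η x * (2 + ‖gradient v x‖ ^ p) := by
  have cv := cont_grad hv
  have hH : Continuous (fun x => ‖gradient v x‖ ^ (p - 2) • gradient v x) := (cont_H hp).comp cv
  have hHc : HasCompactSupport (fun x => ‖gradient v x‖ ^ (p - 2) • gradient v x) :=
    (cs_grad hvc).comp_left (g := fun y : Ed d => ‖y‖ ^ (p - 2) • y) (by simp)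
  obtain ⟨G, hG, hGH⟩ := (hHc.uniformContinuous_of_continuous hH).exists_contDiff_dist_le hε
  have hG1 : ContDiff ℝ 1 G := hG.of_le (by exact_mod_cast le_top)
  have hX : ContDiff ℝ 1 (fun x => η x • G x) := hη.smul hG1
  have hXS : tsupport (fun x => η x • G x) ⊆ tsupport η := ts_sub fun x hx => by simp [hx]
  have key := ibp_lem hp hηc (f := fun n x => u n x - v x) (fun n => (hu n).sub hv) h hX hXS
  refine ⟨fun n => p * ∫ x, ⟪η x • G x, gradient (fun x => u n x - v x) x⟫, by
    simpa using key.const_mul p, fun n => ?_⟩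
  have cu := cont_grad (hu n)
  have hgs : ∀ x, gradient (fun x => u n x - v x) x = gradient (u n) x - gradient v x := by
    intro x
    rw [grad_eq, grad_eq, grad_eq, fderiv_fun_sub ((hu n).differentiable one_ne_zero x)
      (hv.differentiable one_ne_zero x), map_sub]
  simp_rw [hgs, real_inner_smul_left]
  have i1 := int_mul hη.continuous hηc (cont_pow hp cv)
  have i2 : Integrable (fun x => η x * ⟪G x, gradient (u n) x - gradient v x⟫) :=
    int_mul hη.continuous hηc (hG1.continuous.inner (cu.sub cv))
  have i3 := int_mul hη.continuous hηc (cont_pow hp cu)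
  have i4 : Integrable (fun x => η x * (2 + ‖gradient v x‖ ^ p)) :=
    int_mul hη.continuous hηc (continuous_const.add (cont_pow hp cv))
  rw [← integral_const_mul, ← integral_const_mul, ← integral_const_mul,
    ← integral_add i1 (i2.const_mul _), ← integral_add (i3.const_mul _) (i4.const_mul _)]
  refine integral_mono (i1.add (i2.const_mul _)) ((i3.const_mul _).add (i4.const_mul _)) ?_
  intro x
  simp only
  set a := gradient (u n) x
  set b := gradient v x
  have y := young_ineq hp a b
  rw [← real_inner_smul_left] at y
  have y2 : ⟪G x, a - b⟫ - ⟪‖b‖ ^ (p - 2) • b, a - b⟫ ≤ ε * ‖a - b‖ := by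
    rw [← inner_sub_left]
    refine (real_inner_le_norm _ _).trans (mul_le_mul_of_nonneg_right ?_ (norm_nonneg _))
    rw [← dist_eq_norm]
    exact (hGH x).le
  have y3 : ‖a - b‖ ≤ 2 + ‖a‖ ^ p + ‖b‖ ^ p := by
    have := one_add_pow hp (norm_nonneg a)
    have := one_add_pow hp (norm_nonneg b)
    linarith [norm_sub_le a b]
  have y4 : ⟪G x, a - b⟫ ≤ ⟪‖b‖ ^ (p - 2) • b, a - b⟫ + ε * (2 + ‖a‖ ^ p + ‖b‖ ^ p) := by
    have := mul_le_mul_of_nonneg_left y3 hε.le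
    linarith
  have y5 := mul_le_mul_of_nonneg_left y4 (show (0:ℝ) ≤ p by linarith)
  have y6 : ‖b‖ ^ p + p * ⟪G x, a - b⟫ ≤
      (1 + p * ε) * ‖a‖ ^ p + p * ε * (2 + ‖b‖ ^ p) := by linarith
  have := mul_le_mul_of_nonneg_left y6 (h0 x)
  linarith

lemma upper_lem {d : ℕ} {p : ℝ} (hp : 1 < p) {Ω : Set (Ed d)} (hΩ : IsOpen Ω) {V : Ed d → ℝ}
    (hV : LocBddOn Ω V) (hnn : NonnegOn p Ω V) {η v φ u : Ed d → ℝ} (hη : C1On Ω η)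
    (h0 : ∀ x, 0 ≤ η x) (h1 : ∀ x, η x ≤ 1)
    {D : ℝ} (hD0 : 0 ≤ D) (hD : ∀ x, ‖gradient η x‖ ^ p ≤ D * η x ^ (p - 1))
    (hφ : C1On Ω φ) (hηφ : ∀ x ∈ tsupport φ, η x = 1)
    (hv : C1On Ω v) (hu : C1On Ω u) (t : ℝ)
    {ε C : ℝ} (hC0 : 0 ≤ C)
    (hC : ∀ a b : Ed d, |‖a‖ ^ p - ‖b‖ ^ p| ≤ ε * ‖b‖ ^ p + C * ‖a - b‖ ^ p) :
    ∫ x, η x * ‖gradient u x‖ ^ p ≤ Qp p Ω V u +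
      (1 + ε) * (∫ x, η x * ‖gradient v x + t • gradient φ x‖ ^ p) +
      C * (D * ∫ x in tsupport η, ‖u x - v x‖ ^ p) +
      ((∫ x in tsupport η, V x * ‖u x + η x * (v x - u x) + t * φ x‖ ^ p) -
        ∫ x in tsupport η, V x * ‖u x‖ ^ p) := by
  set w : Ed d → ℝ := fun x => u x + η x * (v x - u x) + t * φ x with hw
  have hts : tsupport w ⊆ tsupport u ∪ tsupport η ∪ tsupport φ := by
    refine closure_minimal ?_ (((isClosed_tsupport _).union (isClosed_tsupport _)).union
      (isClosed_tsupport _))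
    intro x hx
    by_contra hn
    simp only [Set.mem_union, not_or] at hn
    refine hx ?_
    simp [hw, ts_zero hn.1.1, ts_zero hn.1.2, ts_zero hn.2]
  have hwC : C1On Ω w := by
    refine ⟨(hu.1.add (hη.1.mul (hv.1.sub hu.1))).add (contDiff_const.mul hφ.1), ?_, ?_⟩
    · exact ((hu.2.1.isCompact.union hη.2.1).union hφ.2.1).of_isClosed_subset
        (isClosed_tsupport _) hts
    · exact hts.trans (Set.union_subset (Set.union_subset hu.2.2 hη.2.2) hφ.2.2)
  have hgw : ∀ x, gradient w x = (1 - η x) • gradient u x +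
      η x • (gradient v x + t • gradient φ x) + (v x - u x) • gradient η x := by
    intro x
    have du := (hu.1.differentiable one_ne_zero x).hasFDerivAt
    have dv := (hv.1.differentiable one_ne_zero x).hasFDerivAt
    have dη := (hη.1.differentiable one_ne_zero x).hasFDerivAt
    have dφ := (hφ.1.differentiable one_ne_zero x).hasFDerivAt
    have dw := (du.add (dη.mul (dv.sub du))).add (dφ.const_mul t)
    have e1 : gradient w x = gradient u x + (η x • (gradient v x - gradient u x) +
        (v x - u x) • gradient η x) + t • gradient φ x := by
      simp only [grad_eq]
      rw [show fderiv ℝ w x = _ from HasFDerivAt.fderiv dw]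
      simp [map_add, map_sub, map_smul]
    have e2 : t • gradient φ x = η x • (t • gradient φ x) := by
      by_cases hx : x ∈ tsupport φ
      · rw [hηφ x hx, one_smul]
      · rw [grad_zero hx]; simp
    rw [e1]
    conv_lhs => rw [e2]
    module
  have hS : IsCompact (tsupport η) := hη.2.1
  have cz : Continuous (fun x => gradient v x + t • gradient φ x) :=
    (cont_grad hv.1).add ((cont_grad hφ.1).const_smul t)
  have cvu : Continuous (fun x => ‖u x - v x‖ ^ p) :=
    cont_pow hp (hu.1.continuous.sub hv.1.continuous)
  have iA := int_mul hη.1.continuous hη.2.1 (cont_pow hp (cont_grad hu.1))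
  have iz := int_mul hη.1.continuous hη.2.1 (cont_pow hp cz)
  have iu := int_grad hp hu
  have iuA : Integrable (fun x => ‖gradient u x‖ ^ p - η x * ‖gradient u x‖ ^ p) := iu.sub iA
  have ivu : Integrable ((tsupport η).indicator fun x => ‖u x - v x‖ ^ p) :=
    (integrable_indicator_iff hS.measurableSet).2 (cvu.continuousOn.integrableOn_compact hS)
  have iuz : Integrable (fun x => ‖gradient u x‖ ^ p - η x * ‖gradient u x‖ ^ p +
      (1 + ε) * (η x * ‖gradient v x + t • gradient φ x‖ ^ p)) := iuA.add (iz.const_mul _)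
  have grad_bd : ∫ x, ‖gradient w x‖ ^ p ≤ (∫ x, ‖gradient u x‖ ^ p) -
      (∫ x, η x * ‖gradient u x‖ ^ p) +
      (1 + ε) * (∫ x, η x * ‖gradient v x + t • gradient φ x‖ ^ p) +
      C * (D * ∫ x in tsupport η, ‖u x - v x‖ ^ p) := by
    rw [← integral_indicator hS.measurableSet, ← integral_sub iu iA, ← integral_const_mul,
      ← integral_const_mul, ← integral_const_mul,
      ← integral_add iuA (iz.const_mul _),
      ← integral_add iuz ((ivu.const_mul _).const_mul _)]
    refine integral_mono (int_grad hp hwC)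
      (iuz.add ((ivu.const_mul _).const_mul _)) fun x => ?_
    simp only
    rw [hgw]
    by_cases hx : x ∈ tsupport η
    · rw [Set.indicator_of_mem hx]
      have := mix_ineq hp hC0 hD0 hC (gradient u x) (gradient v x + t • gradient φ x)
        (gradient η x) (v x - u x) (h0 x) (h1 x) (hD x)
      refine this.trans (le_of_eq ?_)
      rw [Real.norm_eq_abs, abs_sub_comm (u x)]
      ring
    · rw [Set.indicator_of_notMem hx, ts_zero hx, grad_zero hx]
      simp
  have nn := nonneg_c1 hp hΩ hV hnn hwC
  have Vd : (∫ x, V x * ‖w x‖ ^ p) - (∫ x, V x * ‖u x‖ ^ p) =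
      (∫ x in tsupport η, V x * ‖w x‖ ^ p) - ∫ x in tsupport η, V x * ‖u x‖ ^ p := by
    rw [← integral_sub (int_Vu hp hV hwC) (int_Vu hp hV hu),
      ← integral_sub (int_Vu hp hV hwC).integrableOn (int_Vu hp hV hu).integrableOn]
    refine (int_K fun x hx => ?_).symm
    have e : w x = u x := by
      have : x ∉ tsupport φ := fun h' => by
        have := hηφ x h'
        rw [ts_zero hx] at this
        exact zero_ne_one this
      simp [hw, ts_zero hx, ts_zero this]
    rw [e, sub_self]
  rw [Q_eq hp hV hu]
  linarith

lemma min_lem {d : ℕ} {p : ℝ} (hp : 1 < p) {Ω : Set (Ed d)} (hΩ : IsOpen Ω) {V : Ed d → ℝ}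
    (hV : LocBddOn Ω V) (hnn : NonnegOn p Ω V) {η v φ : Ed d → ℝ} (hη : C1On Ω η)
    (h0 : ∀ x, 0 ≤ η x) (h1 : ∀ x, η x ≤ 1)
    {D : ℝ} (hD0 : 0 ≤ D) (hD : ∀ x, ‖gradient η x‖ ^ p ≤ D * η x ^ (p - 1))
    (hφ : C1On Ω φ) (hηφ : ∀ x ∈ tsupport φ, η x = 1)
    (hv : C1On Ω v) {u : ℕ → Ed d → ℝ} (hu : ∀ n, C1On Ω (u n))
    (hQ : Tendsto (fun n => Qp p Ω V (u n)) atTop (𝓝 0))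
    (h : Tendsto (fun n => ∫ x in tsupport η, ‖u n x - v x‖ ^ p) atTop (𝓝 0)) (t : ℝ) :
    (∫ x, η x * ‖gradient v x‖ ^ p) + (∫ x in tsupport η, V x * ‖v x‖ ^ p) ≤
    (∫ x, η x * ‖gradient v x + t • gradient φ x‖ ^ p) +
      ∫ x in tsupport η, V x * ‖v x + t * φ x‖ ^ p := by
  have hS : IsCompact (tsupport η) := hη.2.1
  obtain ⟨M, hM⟩ := hV.2 _ hS hη.2.2
  have t1 := conv_lem hp hS hV.1 hM (fun n => (hu n).1.continuous) hv.1.continuous h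
  have cw : ∀ n, Continuous (fun x => u n x + η x * (v x - u n x) + t * φ x) := fun n =>
    ((hu n).1.continuous.add (hη.1.continuous.mul
      (hv.1.continuous.sub (hu n).1.continuous))).add (continuous_const.mul hφ.1.continuous)
  have cw0 : Continuous (fun x => v x + t * φ x) :=
    hv.1.continuous.add (continuous_const.mul hφ.1.continuous)
  have t2 := conv_lem hp hS hV.1 hM cw cw0 (by
    refine squeeze_zero (fun n => integral_nonneg fun x => by positivity) (fun n => ?_) h
    refine setIntegral_mono
      ((cont_pow hp ((cw n).sub cw0)).continuousOn.integrableOn_compact hS)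
      ((cont_pow hp ((hu n).1.continuous.sub hv.1.continuous)).continuousOn.integrableOn_compact
        hS) fun x => ?_
    refine Real.rpow_le_rpow (norm_nonneg _) ?_ (by linarith)
    rw [show u n x + η x * (v x - u n x) + t * φ x - (v x + t * φ x) =
      (1 - η x) * (u n x - v x) by ring, norm_mul,
      Real.norm_of_nonneg (sub_nonneg.2 (h1 x))]
    exact mul_le_of_le_one_left (norm_nonneg _) (by linarith [h0 x]))
  set A : ℕ → ℝ := fun n => ∫ x, η x * ‖gradient (u n) x‖ ^ p
  set Iv := ∫ x, η x * ‖gradient v x‖ ^ p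
  set Iz := ∫ x, η x * ‖gradient v x + t • gradient φ x‖ ^ p
  set J0 := ∫ x in tsupport η, V x * ‖v x‖ ^ p
  set J1 := ∫ x in tsupport η, V x * ‖v x + t * φ x‖ ^ p
  set Kc := ∫ x, η x * (2 + ‖gradient v x‖ ^ p)
  have hε : ∀ ε : ℝ, 0 < ε → Iv ≤ (1 + p * ε) * ((1 + ε) * Iz + (J1 - J0)) + p * ε * Kc := by
    intro ε hε
    obtain ⟨C, hC0, hC⟩ := pow_ineq hp hε
    obtain ⟨o, ho, hlow⟩ := lower_lem hp hη.1 hη.2.1 h0 hv.1 hv.2.1 (fun n => (hu n).1) h hε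
    have hup := fun n => upper_lem hp hΩ hV hnn hη h0 h1 hD0 hD hφ hηφ hv (hu n) t hC0
      (fun a b => hC a b)
    have L1 : Tendsto (fun n => Iv + o n) atTop (𝓝 (Iv + 0)) := ho.const_add Iv
    have L2 := ((((hQ.add_const ((1 + ε) * Iz)).add ((h.const_mul D).const_mul C)).add
      (t2.sub t1)).const_mul (1 + p * ε)).add_const (p * ε * Kc)
    have := le_of_tendsto_of_tendsto' L1 L2 fun n => (hlow n).trans
      (add_le_add_left (mul_le_mul_of_nonneg_left (hup n) (by positivity)) _)
    simpa using this
  have lim : Tendsto (fun ε : ℝ => (1 + p * ε) * ((1 + ε) * Iz + (J1 - J0)) + p * ε * Kc)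
      (𝓝[>] 0) (𝓝 (Iz + (J1 - J0))) := by
    have : Continuous (fun ε : ℝ => (1 + p * ε) * ((1 + ε) * Iz + (J1 - J0)) + p * ε * Kc) := by
      fun_prop
    have := (this.tendsto 0).mono_left (nhdsWithin_le_nhds (s := Set.Ioi 0))
    simpa using this
  have := ge_of_tendsto lim (by
    filter_upwards [self_mem_nhdsWithin] with ε h using hε ε h)
  linarith

lemma deriv_lem {d : ℕ} {p : ℝ} (hp : 1 < p) {S : Set (Ed d)} (hS : IsCompact S)
    {V : Ed d → ℝ} (hV : Measurable V) {M : ℝ}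
    (hM : ∀ᵐ x ∂(volume : Measure (Ed d)), x ∈ S → |V x| ≤ M)
    {η v φ : Ed d → ℝ} {b c : Ed d → Ed d} (hη : Continuous η) (hv : Continuous v)
    (hφ : Continuous φ) (hb : Continuous b) (hc : Continuous c)
    (hmin : ∀ t : ℝ, (∫ x in S, (η x * ‖b x‖ ^ p + V x * ‖v x‖ ^ p)) ≤
      ∫ x in S, (η x * ‖b x + t • c x‖ ^ p + V x * ‖v x + t * φ x‖ ^ p)) :
    ∫ x in S, (η x * (p * ⟪‖b x‖ ^ (p - 2) • b x, c x⟫) +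
      V x * (p * ⟪‖v x‖ ^ (p - 2) • v x, φ x⟫)) = 0 := by
  have hM' : ∀ᵐ x ∂(volume.restrict S), x ∈ S ∧ |V x| ≤ M := by
    rw [ae_restrict_iff' hS.measurableSet]
    filter_upwards [hM] with x hx hxK using ⟨hxK, hx hxK⟩
  set g1 : ℝ → Ed d → ℝ := fun t x =>
    p * ⟪‖b x + t • c x‖ ^ (p - 2) • (b x + t • c x), c x⟫ with hg1
  set g2 : ℝ → Ed d → ℝ := fun t x =>
    p * ⟪‖v x + t • φ x‖ ^ (p - 2) • (v x + t • φ x), φ x⟫ with hg2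
  have cg1 : Continuous (fun q : ℝ × Ed d => η q.2 * g1 q.1 q.2) := by
    have := (cont_H (F := Ed d) hp).comp
      (show Continuous (fun q : ℝ × Ed d => b q.2 + q.1 • c q.2) by fun_prop)
    exact (hη.comp continuous_snd).mul
      (continuous_const.mul (this.inner (hc.comp continuous_snd)))
  have cg2 : Continuous (fun q : ℝ × Ed d => g2 q.1 q.2) := by
    have := (cont_H (F := ℝ) hp).comp
      (show Continuous (fun q : ℝ × Ed d => v q.2 + q.1 • φ q.2) by fun_prop)
    exact (continuous_const.mul (this.inner (hφ.comp continuous_snd)))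
  have hcomp : IsCompact (Metric.closedBall (0:ℝ) 1 ×ˢ S) :=
    (isCompact_closedBall _ _).prod hS
  obtain ⟨B1, hB1⟩ := hcomp.exists_bound_of_continuousOn cg1.continuousOn
  obtain ⟨B2, hB2⟩ := hcomp.exists_bound_of_continuousOn cg2.continuousOn
  have m1 : ∀ t : ℝ, AEStronglyMeasurable
      (fun x => η x * ‖b x + t • c x‖ ^ p + V x * ‖v x + t • φ x‖ ^ p) (volume.restrict S) := by
    intro t
    have c1 : Continuous (fun x => η x * ‖b x + t • c x‖ ^ p) :=
      hη.mul (cont_pow hp (hb.add (hc.const_smul t)))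
    have c2 : Continuous (fun x => ‖v x + t • φ x‖ ^ p) :=
      cont_pow hp (hv.add (hφ.const_smul t))
    exact c1.aestronglyMeasurable.add (hV.aestronglyMeasurable.mul c2.aestronglyMeasurable)
  have m2 : AEStronglyMeasurable
      (fun x => η x * g1 0 x + V x * g2 0 x) (volume.restrict S) := by
    have c1 : Continuous (fun x => η x * g1 0 x) :=
      cg1.comp (continuous_const.prodMk continuous_id)
    have c2 : Continuous (fun x => g2 0 x) :=
      cg2.comp (continuous_const.prodMk continuous_id)
    exact c1.aestronglyMeasurable.add (hV.aestronglyMeasurable.mul c2.aestronglyMeasurable)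
  have i0 : Integrable (fun x => η x * ‖b x + (0:ℝ) • c x‖ ^ p + V x * ‖v x + (0:ℝ) • φ x‖ ^ p)
      (volume.restrict S) := by
    have c1 : Continuous (fun x => η x * ‖b x + (0:ℝ) • c x‖ ^ p) :=
      hη.mul (cont_pow hp (hb.add (hc.const_smul (0:ℝ))))
    have c2 : Continuous (fun x => ‖v x + (0:ℝ) • φ x‖ ^ p) :=
      cont_pow hp (hv.add (hφ.const_smul (0:ℝ)))
    refine (c1.continuousOn.integrableOn_compact hS).add ?_
    refine Integrable.mono' (g := fun x => M * |‖v x + (0:ℝ) • φ x‖ ^ p|)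
      ((c2.continuousOn.integrableOn_compact hS).abs.const_mul M)
      (hV.aestronglyMeasurable.mul c2.aestronglyMeasurable) ?_
    filter_upwards [hM'] with x hx
    rw [Real.norm_eq_abs, abs_mul]
    exact mul_le_mul_of_nonneg_right hx.2 (abs_nonneg _)
  have hd := (hasDerivAt_integral_of_dominated_loc_of_deriv_le (μ := volume.restrict S)
    (F := fun t x => η x * ‖b x + t • c x‖ ^ p + V x * ‖v x + t • φ x‖ ^ p)
    (F' := fun t x => η x * g1 t x + V x * g2 t x) (x₀ := (0:ℝ))
    (s := Metric.ball 0 1) (bound := fun _ => B1 + M * B2)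
    (Metric.ball_mem_nhds _ one_pos) (Eventually.of_forall m1) i0 m2
    (by
      filter_upwards [hM'] with x hx t ht
      have hmem : (t, x) ∈ Metric.closedBall (0:ℝ) 1 ×ˢ S :=
        ⟨Metric.ball_subset_closedBall ht, hx.1⟩
      have k1 := hB1 _ hmem
      have k2 := hB2 _ hmem
      simp only at k1 k2
      refine (norm_add_le _ _).trans (add_le_add k1 ?_)
      rw [norm_mul, Real.norm_eq_abs (V x)]
      exact mul_le_mul hx.2 k2 (norm_nonneg _) ((abs_nonneg _).trans hx.2))
    (continuousOn_const.integrableOn_compact hS)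
    (by
      refine Eventually.of_forall fun x t _ => ?_
      have gen : ∀ {F : Type} [NormedAddCommGroup F] [InnerProductSpace ℝ F] (y z : F),
          HasDerivAt (fun t : ℝ => ‖y + t • z‖ ^ p)
            (p * ⟪‖y + t • z‖ ^ (p - 2) • (y + t • z), z⟫) t := by
        intro F _ _ y z
        have l : HasDerivAt (fun t : ℝ => y + t • z) z t := by
          simpa using ((hasDerivAt_id t).smul_const z).const_add y
        have := (hasFDerivAt_norm_rpow (y + t • z) hp).comp_hasDerivAt t l
        refine this.congr_deriv ?_
        rw [real_inner_smul_left, ← mul_assoc]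
        rfl
      exact ((gen (b x) (c x)).const_mul (η x)).add ((gen (v x) (φ x)).const_mul (V x)))).2
  have hloc : IsLocalMin (fun t : ℝ => ∫ x in S,
      (η x * ‖b x + t • c x‖ ^ p + V x * ‖v x + t • φ x‖ ^ p)) 0 := by
    refine Eventually.of_forall fun t => ?_
    simpa using hmin t
  have := hloc.hasDerivAt_eq_zero hd
  simpa [hg1, hg2] using this

theorem stmt12 (d : ℕ) (p : ℝ) (hp : 1 < p) (Ω : Set (Ed d))
    (hopen : IsOpen Ω) (hconn : IsConnected Ω)
    (V : Ed d → ℝ) (hV : LocBddOn Ω V)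
    (hnn : NonnegOn p Ω V)
    (v : Ed d → ℝ) (hgs : IsGroundStateOn p Ω V v) :
    IsSolOn p Ω V v := by
  obtain ⟨hv1, hvpos, u, ⟨hu, -, -, hQ⟩, hlim⟩ := hgs
  refine ⟨hv1, hvpos, fun φ hφ => ?_⟩
  obtain ⟨η, hη, h0, h1, hηφ, D, hD0, hD⟩ := cutoff2 hp hopen hφ.2.1.isCompact hφ.2.2
  have hS : IsCompact (tsupport η) := hη.2.1
  obtain ⟨χ, hχ, -, -, hχ1⟩ := cutoff hopen hS hη.2.2
  have hvS : ∀ᶠ x in 𝓝ˢ (tsupport η), χ x * v x = v x := by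
    filter_upwards [hχ1] with x hx
    rw [hx, one_mul]
  set v' : Ed d → ℝ := fun x => χ x * v x with hv'
  have hts : tsupport v' ⊆ tsupport χ := ts_sub fun x hx => by simp [hv', hx]
  have hv'C : C1On Ω v' := by
    refine ⟨?_, hχ.2.1.of_isClosed_subset (isClosed_tsupport _) hts, hts.trans hχ.2.2⟩
    rw [contDiff_iff_contDiffAt]
    intro x
    by_cases hx : x ∈ Ω
    · exact hχ.c1.1.contDiffAt.mul (hv1.contDiffAt (hopen.mem_nhds hx))
    · have hx' : x ∉ tsupport v' := fun h' => hx (hχ.2.2 (hts h'))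
      refine (contDiffAt_const (c := (0:ℝ))).congr_of_eventuallyEq ?_
      exact notMem_tsupport_iff_eventuallyEq.1 hx'
  have hφS : tsupport φ ⊆ tsupport η := fun x hx => subset_tsupport η (by
    simp [Function.mem_support, hηφ x hx])
  have hlim' : Tendsto (fun n => ∫ x in tsupport η, ‖u n x - v' x‖ ^ p) atTop (𝓝 0) := by
    refine (hlim _ hS hη.2.2).congr fun n => ?_
    refine setIntegral_congr_fun hS.measurableSet fun x hx => ?_
    have := hvS.self_of_nhdsSet x hx
    simp only [hv', this, Real.norm_eq_abs]
  obtain ⟨M, hM⟩ := hV.2 _ hS hη.2.2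
  have hmin := min_lem hp hopen hV hnn hη.c1 h0 h1 hD0 hD hφ.c1 hηφ hv'C
    (fun n => (hu n).c1) hQ hlim'
  have cb := cont_grad hv'C.1
  have cc := cont_grad hφ.c1.1
  have cφ := hφ.c1.1.continuous
  have cv := hv'C.1.continuous
  have key := deriv_lem hp hS hV.1 hM hη.c1.1.continuous cv cφ cb cc (by
    have hs : ∀ t : ℝ, (∫ x in tsupport η, (η x * ‖gradient v' x + t • gradient φ x‖ ^ p +
        V x * ‖v' x + t * φ x‖ ^ p)) =
        (∫ x, η x * ‖gradient v' x + t • gradient φ x‖ ^ p) +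
        ∫ x in tsupport η, V x * ‖v' x + t * φ x‖ ^ p := by
      intro t
      have c1 : Continuous (fun x => ‖gradient v' x + t • gradient φ x‖ ^ p) :=
        cont_pow hp (cb.add (cc.const_smul t))
      have hz : C1On Ω (fun x => v' x + t * φ x) := by
        have hts2 : tsupport (fun x => v' x + t * φ x) ⊆ tsupport v' ∪ tsupport φ := by
          refine closure_minimal ?_ ((isClosed_tsupport _).union (isClosed_tsupport _))
          intro x hx
          by_contra hn
          simp only [Set.mem_union, not_or] at hn
          exact hx (by simp [ts_zero hn.1, ts_zero hn.2])
        exact ⟨hv'C.1.add (contDiff_const.mul hφ.c1.1),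
          (hv'C.2.1.isCompact.union hφ.2.1).of_isClosed_subset (isClosed_tsupport _) hts2,
          hts2.trans (Set.union_subset hv'C.2.2 hφ.2.2)⟩
      rw [integral_add (int_mul hη.c1.1.continuous hη.2.1 c1).integrableOn
        (int_Vu hp hV hz).integrableOn, int_K fun x hx => by rw [ts_zero hx, zero_mul]]
    intro t
    have h0' := hs 0
    simp only [zero_smul, zero_mul, add_zero] at h0'
    rw [hs t, h0']
    exact hmin t)
  have hoff : ∀ x, x ∉ tsupport φ → ‖gradient v x‖ ^ (p - 2) * ⟪gradient v x, gradient φ x⟫ +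
      V x * v x ^ (p - 1) * φ x = 0 := by
    intro x hx
    rw [grad_zero hx, ts_zero hx]; simp
  rw [int_K fun x hx => hoff x fun h' => hx (hφ.2.2 h'),
    ← int_K (K := tsupport η) fun x hx => hoff x fun h' => hx (hφS h')]
  have heq : ∀ x, η x * (p * ⟪‖gradient v' x‖ ^ (p - 2) • gradient v' x, gradient φ x⟫) +
      V x * (p * ⟪‖v' x‖ ^ (p - 2) • v' x, φ x⟫) = p * (‖gradient v x‖ ^ (p - 2) *
        ⟪gradient v x, gradient φ x⟫ + V x * v x ^ (p - 1) * φ x) := by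
    intro x
    by_cases hx : x ∈ tsupport φ
    · have hev : v' =ᶠ[𝓝 x] v := hvS.filter_mono (nhds_le_nhdsSet (hφS hx))
      have hpos := hvpos x (hφ.2.2 hx)
      rw [hev.gradient_eq, hev.self_of_nhds, hηφ x hx, real_inner_smul_left,
        real_inner_smul_left, Real.norm_of_nonneg hpos.le,
        show p - 1 = (p - 2) + 1 by ring, Real.rpow_add_one hpos.ne']
      have : ⟪v x, φ x⟫ = v x * φ x := by simp [mul_comm]
      rw [this]
      ring
    · rw [hoff x hx, grad_zero hx, ts_zero hx]; simp
  simp_rw [heq] at key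
  rw [integral_const_mul] at key
  exact (mul_eq_zero.1 key).resolve_left (by linarith)
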